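/- arXiv:2303.02183 — 2 statements merged into one kernel-verified Lean document; each statement's English description precedes it below -/
import Mathlib

section
/- WOP is a metric on M(ℝ^d): for all μ, ν, η ∈ M(ℝ^d), WOP(μ,ν) ≥ 0; WOP(μ,ν) = 0 if and only if μ = ν; WOP(μ,ν) = WOP(ν,μ); and WOP(μ,ν) ≤ WOP(μ,η) + WOP(η,ν). -/
open MeasureTheory

noncomputable section

abbrev Euc (d : ℕ) := EuclideanSpace ℝ (Fin d)

variable {d : ℕ}

/-- Total mass of a measure. -/
def mass (μ : Measure (Euc d)) : ℝ := (μ Set.univ).toReal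

/-- Second moment centered at `x₀`. -/
def sndMoment (x₀ : Euc d) (μ : Measure (Euc d)) : ℝ := ∫ x, ‖x - x₀‖ ^ 2 ∂μ

/-- `μ ∈ M(ℝ^d)`: finite positive measure with finite second moment. -/
def MemM (μ : Measure (Euc d)) : Prop :=
  IsFiniteMeasure μ ∧ Integrable (fun x => ‖x‖ ^ 2) μ

/-- `μ ∈ P₂(ℝ^d)`: probability measure with finite second moment. -/
def MemP2 (μ : Measure (Euc d)) : Prop :=
  IsProbabilityMeasure μ ∧ Integrable (fun x => ‖x‖ ^ 2) μ

/-- Squared 2-Wasserstein distance, as an infimum over couplings. -/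
def W2sq (μ ν : Measure (Euc d)) : ℝ :=
  sInf { r : ℝ | ∃ π : Measure (Euc d × Euc d),
    π.map Prod.fst = μ ∧ π.map Prod.snd = ν ∧ r = ∫ p, ‖p.1 - p.2‖ ^ 2 ∂π }

/-- 2-Wasserstein distance. -/
def W2 (μ ν : Measure (Euc d)) : ℝ := Real.sqrt (W2sq μ ν)

/-- The dilation `T_a(x) = a (x - x₀) + x₀`. -/
def dil (x₀ : Euc d) (a : ℝ) (x : Euc d) : Euc d := a • (x - x₀) + x₀

/-- Normalization `μ̄` of `μ`, with the convention `μ̄ = δ_{x₀}` for the null measure. -/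
def nm (x₀ : Euc d) (μ : Measure (Euc d)) : Measure (Euc d) :=
  if μ Set.univ = 0 then Measure.dirac x₀ else (μ Set.univ)⁻¹ • μ

/-- Squared WOP metric with reference point `x₀`. -/
def WOP2 (x₀ : Euc d) (μ ν : Measure (Euc d)) : ℝ :=
  (mass μ - mass ν) ^ 2 +
    W2sq ((nm x₀ μ).map (dil x₀ (mass μ))) ((nm x₀ ν).map (dil x₀ (mass ν)))

/-- The WOP metric with reference point `x₀`. -/
def WOP (x₀ : Euc d) (μ ν : Measure (Euc d)) : ℝ := Real.sqrt (WOP2 x₀ μ ν)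


open ProbabilityTheory in
/-- Gluing of couplings along a common marginal. -/
lemma exists_gluing {X Y Z : Type*} [MeasurableSpace X] [StandardBorelSpace X] [Nonempty X]
    [MeasurableSpace Y] [MeasurableSpace Z] [StandardBorelSpace Z] [Nonempty Z]
    (π₁ : Measure (X × Y)) (π₂ : Measure (Y × Z)) [IsFiniteMeasure π₁] [IsFiniteMeasure π₂]
    (h : π₁.map Prod.snd = π₂.map Prod.fst) :
    ∃ γ : Measure (Y × X × Z),
      γ.map (fun p => (p.2.1, p.1)) = π₁ ∧ γ.map (fun p => (p.1, p.2.2)) = π₂ := by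
  set ρ : Measure (Y × X) := π₁.map Prod.swap with hρ
  have hρ_fst : ρ.fst = π₂.fst := by
    rw [hρ, Measure.fst, Measure.map_map measurable_fst measurable_swap]
    exact h
  have key₁ : (π₂.fst ⊗ₘ (ρ.condKernel ×ₖ π₂.condKernel)).map (Prod.map id Prod.fst) = ρ := by
    rw [← Measure.compProd_map measurable_fst, ← Kernel.fst_eq, Kernel.fst_prod, ← hρ_fst,
      ρ.disintegrate]
  have key₂ : (π₂.fst ⊗ₘ (ρ.condKernel ×ₖ π₂.condKernel)).map (Prod.map id Prod.snd) = π₂ := by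
    rw [← Measure.compProd_map measurable_snd, ← Kernel.snd_eq, Kernel.snd_prod,
      π₂.disintegrate]
  refine ⟨π₂.fst ⊗ₘ (ρ.condKernel ×ₖ π₂.condKernel), ?_, key₂⟩
  have hcomp : (fun p : Y × X × Z => (p.2.1, p.1)) = Prod.swap ∘ Prod.map id Prod.fst := rfl
  rw [hcomp, ← Measure.map_map measurable_swap (by fun_prop), key₁, hρ,
    Measure.map_map measurable_swap measurable_swap]
  simp

lemma isProbabilityMeasure_of_map {X Y : Type*} [MeasurableSpace X] [MeasurableSpace Y]
    {π : Measure X} {μ : Measure Y} {f : X → Y} (hf : Measurable f) (hμ : IsProbabilityMeasure μ)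
    (h : π.map f = μ) : IsProbabilityMeasure π :=
  (Measure.isProbabilityMeasure_map_iff hf.aemeasurable).1 (h ▸ hμ)

lemma norm_sub_sq_le_two_mul {E : Type*} [SeminormedAddCommGroup E] (x y : E) :
    ‖x - y‖ ^ 2 ≤ 2 * ‖x‖ ^ 2 + 2 * ‖y‖ ^ 2 := by
  nlinarith [norm_sub_le x y, norm_nonneg (x - y), sq_nonneg (‖x‖ - ‖y‖)]

lemma norm_add_sq_le_weighted {E : Type*} [SeminormedAddCommGroup E] {A B : ℝ} (hA : 0 < A)
    (hB : 0 < B) (x y : E) :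
    ‖x + y‖ ^ 2 ≤ (1 + B / A) * ‖x‖ ^ 2 + (1 + A / B) * ‖y‖ ^ 2 := by
  have h1 : ‖x + y‖ ^ 2 ≤ (‖x‖ + ‖y‖) ^ 2 :=
    pow_le_pow_left₀ (norm_nonneg _) (norm_add_le x y) 2
  have h2 : (1 + B / A) * ‖x‖ ^ 2 + (1 + A / B) * ‖y‖ ^ 2 - (‖x‖ + ‖y‖) ^ 2
      = (B * ‖x‖ - A * ‖y‖) ^ 2 / (A * B) := by
    field_simp
    ring
  have h3 : 0 ≤ (B * ‖x‖ - A * ‖y‖) ^ 2 / (A * B) := by positivity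
  linarith

lemma integrable_norm_sub_sq {μ ν : Measure (Euc d)} (hμ : MemP2 μ) (hν : MemP2 ν)
    {π : Measure (Euc d × Euc d)} (h1 : π.map Prod.fst = μ) (h2 : π.map Prod.snd = ν) :
    Integrable (fun p => ‖p.1 - p.2‖ ^ 2) π := by
  subst h1 h2
  have hfst : Integrable (fun p : Euc d × Euc d => ‖p.1‖ ^ 2) π :=
    hμ.2.comp_measurable measurable_fst
  have hsnd : Integrable (fun p : Euc d × Euc d => ‖p.2‖ ^ 2) π :=
    hν.2.comp_measurable measurable_snd
  refine ((hfst.const_mul 2).add (hsnd.const_mul 2)).mono' (by fun_prop) (.of_forall fun p => ?_)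
  rw [Real.norm_of_nonneg (by positivity)]
  exact norm_sub_sq_le_two_mul p.1 p.2

lemma W2sq_nonneg (μ ν : Measure (Euc d)) : 0 ≤ W2sq μ ν := by
  refine Real.sInf_nonneg ?_
  rintro r ⟨π, -, -, rfl⟩
  exact integral_nonneg fun p => by positivity

lemma W2sq_le {μ ν : Measure (Euc d)} {π : Measure (Euc d × Euc d)}
    (h1 : π.map Prod.fst = μ) (h2 : π.map Prod.snd = ν) :
    W2sq μ ν ≤ ∫ p, ‖p.1 - p.2‖ ^ 2 ∂π := by
  refine csInf_le ⟨0, ?_⟩ ⟨π, h1, h2, rfl⟩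
  rintro r ⟨π, -, -, rfl⟩
  exact integral_nonneg fun p => by positivity

lemma exists_coupling_lt {μ ν : Measure (Euc d)} (hμ : MemP2 μ) (hν : MemP2 ν) {A : ℝ}
    (hA : W2 μ ν < A) : ∃ π : Measure (Euc d × Euc d),
      π.map Prod.fst = μ ∧ π.map Prod.snd = ν ∧ ∫ p, ‖p.1 - p.2‖ ^ 2 ∂π < A ^ 2 := by
  have := hμ.1
  have := hν.1
  have hlt : W2sq μ ν < A ^ 2 := Real.lt_sq_of_sqrt_lt hA
  have hne : { r : ℝ | ∃ π : Measure (Euc d × Euc d),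
      π.map Prod.fst = μ ∧ π.map Prod.snd = ν ∧ r = ∫ p, ‖p.1 - p.2‖ ^ 2 ∂π }.Nonempty :=
    ⟨_, μ.prod ν, by simp [Measure.map_fst_prod], by simp [Measure.map_snd_prod], rfl⟩
  obtain ⟨r, ⟨π, h1, h2, rfl⟩, hr⟩ := exists_lt_of_csInf_lt hne hlt
  exact ⟨π, h1, h2, hr⟩

lemma W2sq_self (μ : Measure (Euc d)) : W2sq μ μ = 0 := by
  refine le_antisymm ?_ (W2sq_nonneg μ μ)
  have hdiag : Measurable fun x : Euc d => (x, x) := by fun_prop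
  have h := W2sq_le (μ := μ) (ν := μ) (π := μ.map fun x => (x, x))
    (by rw [Measure.map_map measurable_fst hdiag]; exact Measure.map_id)
    (by rw [Measure.map_map measurable_snd hdiag]; exact Measure.map_id)
  rw [integral_map hdiag.aemeasurable (by fun_prop)] at h
  simpa using h

lemma W2sq_comm (μ ν : Measure (Euc d)) : W2sq μ ν = W2sq ν μ := by
  have key : ∀ μ ν : Measure (Euc d), ∀ r : ℝ,
      (∃ π : Measure (Euc d × Euc d),
        π.map Prod.fst = μ ∧ π.map Prod.snd = ν ∧ r = ∫ p, ‖p.1 - p.2‖ ^ 2 ∂π) →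
      ∃ π : Measure (Euc d × Euc d),
        π.map Prod.fst = ν ∧ π.map Prod.snd = μ ∧ r = ∫ p, ‖p.1 - p.2‖ ^ 2 ∂π := by
    rintro μ ν r ⟨π, h1, h2, rfl⟩
    refine ⟨π.map Prod.swap, ?_, ?_, ?_⟩
    · rw [Measure.map_map measurable_fst measurable_swap]
      exact h2
    · rw [Measure.map_map measurable_snd measurable_swap]
      exact h1
    · rw [integral_map measurable_swap.aemeasurable (by fun_prop)]
      simp only [Prod.fst_swap, Prod.snd_swap, norm_sub_rev]
  exact congrArg sInf (Set.ext fun r => ⟨key μ ν r, key ν μ r⟩)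

lemma W2_triangle {μ ν η : Measure (Euc d)} (hμ : MemP2 μ) (hν : MemP2 ν) (hη : MemP2 η) :
    W2 μ ν ≤ W2 μ η + W2 η ν := by
  have hlt : ∀ A B : ℝ, W2 μ η < A → W2 η ν < B → W2 μ ν ≤ A + B := by
    intro A B hA hB
    have hA0 : 0 < A := (Real.sqrt_nonneg _).trans_lt hA
    have hB0 : 0 < B := (Real.sqrt_nonneg _).trans_lt hB
    obtain ⟨π₁, h11, h12, h1⟩ := exists_coupling_lt hμ hη hA
    obtain ⟨π₂, h21, h22, h2⟩ := exists_coupling_lt hη hν hB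
    have := isProbabilityMeasure_of_map measurable_fst hμ.1 h11
    have := isProbabilityMeasure_of_map measurable_fst hη.1 h21
    obtain ⟨γ, hγ1, hγ2⟩ := exists_gluing π₁ π₂ (h12.trans h21.symm)
    have hm1 : Measurable fun p : Euc d × Euc d × Euc d => (p.2.1, p.1) := by fun_prop
    have hm2 : Measurable fun p : Euc d × Euc d × Euc d => (p.1, p.2.2) := by fun_prop
    have hm : Measurable fun p : Euc d × Euc d × Euc d => (p.2.1, p.2.2) := by fun_prop
    have i1 : Integrable (fun p : Euc d × Euc d × Euc d => ‖p.2.1 - p.1‖ ^ 2) γ := by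
      have h := integrable_norm_sub_sq hμ hη h11 h12
      rw [← hγ1] at h
      exact h.comp_measurable hm1
    have i2 : Integrable (fun p : Euc d × Euc d × Euc d => ‖p.1 - p.2.2‖ ^ 2) γ := by
      have h := integrable_norm_sub_sq hη hν h21 h22
      rw [← hγ2] at h
      exact h.comp_measurable hm2
    rw [← hγ1, integral_map hm1.aemeasurable (by fun_prop)] at h1
    rw [← hγ2, integral_map hm2.aemeasurable (by fun_prop)] at h2
    have hle := W2sq_le (μ := μ) (ν := ν) (π := γ.map fun p => (p.2.1, p.2.2))
      (by
        rw [Measure.map_map measurable_fst hm, ← h11, ← hγ1, Measure.map_map measurable_fst hm1]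
        rfl)
      (by
        rw [Measure.map_map measurable_snd hm, ← h22, ← hγ2, Measure.map_map measurable_snd hm2]
        rfl)
    rw [integral_map hm.aemeasurable (by fun_prop)] at hle
    refine Real.sqrt_le_iff.2 ⟨by positivity, hle.trans ?_⟩
    calc ∫ p, ‖p.2.1 - p.2.2‖ ^ 2 ∂γ
        ≤ ∫ p, ((1 + B / A) * ‖p.2.1 - p.1‖ ^ 2 + (1 + A / B) * ‖p.1 - p.2.2‖ ^ 2) ∂γ := by
          refine integral_mono_of_nonneg (.of_forall fun p => by positivity)
            ((i1.const_mul _).add (i2.const_mul _)) (.of_forall fun p => ?_)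
          simpa using norm_add_sq_le_weighted hA0 hB0 (p.2.1 - p.1) (p.1 - p.2.2)
      _ = (1 + B / A) * ∫ p, ‖p.2.1 - p.1‖ ^ 2 ∂γ
          + (1 + A / B) * ∫ p, ‖p.1 - p.2.2‖ ^ 2 ∂γ := by
          rw [integral_add (i1.const_mul _) (i2.const_mul _), integral_const_mul,
            integral_const_mul]
      _ ≤ (1 + B / A) * A ^ 2 + (1 + A / B) * B ^ 2 := by gcongr
      _ = (A + B) ^ 2 := by
          field_simp
          ring
  refine le_of_forall_pos_le_add fun ε hε => ?_
  linarith [hlt (W2 μ η + ε / 2) (W2 η ν + ε / 2) (by linarith) (by linarith)]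

lemma norm_exp_ofReal_mul_I_sub_le (a b : ℝ) :
    ‖Complex.exp (a * Complex.I) - Complex.exp (b * Complex.I)‖ ≤ |a - b| := by
  have h : Complex.exp (a * Complex.I) - Complex.exp (b * Complex.I)
      = Complex.exp (b * Complex.I) * (Complex.exp (Complex.I * (a - b : ℝ)) - 1) := by
    rw [mul_sub, ← Complex.exp_add, mul_one]
    congr 2
    push_cast
    ring
  rw [h, norm_mul, Complex.norm_exp_ofReal_mul_I, one_mul]
  exact Real.norm_exp_I_mul_ofReal_sub_one_le

lemma eq_of_W2sq_eq_zero {μ ν : Measure (Euc d)} (hμ : MemP2 μ) (hν : MemP2 ν)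
    (h : W2sq μ ν = 0) : μ = ν := by
  have := hμ.1
  have := hν.1
  refine Measure.ext_of_charFun (funext fun t => ?_)
  have hbound : ∀ ε : ℝ, 0 < ε → ‖charFun μ t - charFun ν t‖ ≤ ‖t‖ * ε := by
    intro ε hε
    obtain ⟨π, h1, h2, hlt⟩ := exists_coupling_lt hμ hν (A := ε) (by simpa [W2, h] using hε)
    have hprob := isProbabilityMeasure_of_map measurable_fst hμ.1 h1
    have hint := integrable_norm_sub_sq hμ hν h1 h2
    have hexp : ∀ f : Euc d × Euc d → Euc d, Measurable f →
        Integrable (fun p => Complex.exp (inner ℝ (f p) t * Complex.I)) π := by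
      intro f hf
      refine (integrable_const (1 : ℝ)).mono' (by fun_prop) (.of_forall fun p => ?_)
      rw [Complex.norm_exp_ofReal_mul_I]
    rw [charFun_apply, charFun_apply, ← h1, ← h2,
      integral_map measurable_fst.aemeasurable (by fun_prop),
      integral_map measurable_snd.aemeasurable (by fun_prop),
      ← integral_sub (hexp _ measurable_fst) (hexp _ measurable_snd)]
    have hdom : Integrable (fun p : Euc d × Euc d =>
        ‖t‖ * (ε / 2 + (2 * ε)⁻¹ * ‖p.1 - p.2‖ ^ 2)) π :=
      ((integrable_const (ε / 2)).add (hint.const_mul _)).const_mul _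
    refine (norm_integral_le_of_norm_le hdom (.of_forall fun p => ?_)).trans ?_
    · refine (norm_exp_ofReal_mul_I_sub_le _ _).trans ?_
      rw [← inner_sub_left, mul_comm]
      refine (abs_real_inner_le_norm _ _).trans ?_
      gcongr
      have hsq : ε / 2 + (2 * ε)⁻¹ * ‖p.1 - p.2‖ ^ 2 - ‖p.1 - p.2‖
          = (ε - ‖p.1 - p.2‖) ^ 2 / (2 * ε) := by
        field_simp
        ring
      have hnonneg : 0 ≤ (ε - ‖p.1 - p.2‖) ^ 2 / (2 * ε) := by positivity
      linarith
    · rw [integral_const_mul, integral_add (integrable_const _) (hint.const_mul _),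
        integral_const_mul, integral_const, probReal_univ, one_smul]
      gcongr
      calc ε / 2 + (2 * ε)⁻¹ * ∫ p, ‖p.1 - p.2‖ ^ 2 ∂π
          ≤ ε / 2 + (2 * ε)⁻¹ * ε ^ 2 := by gcongr
        _ = ε := by
          field_simp
          ring
  refine eq_of_norm_sub_le_zero (le_of_forall_pos_le_add fun ε hε => ?_)
  have ht : 0 < ‖t‖ + 1 := by positivity
  calc ‖charFun μ t - charFun ν t‖ ≤ ‖t‖ * (ε / (‖t‖ + 1)) := hbound _ (by positivity)
    _ = ‖t‖ / (‖t‖ + 1) * ε := by ring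
    _ ≤ 1 * ε := by
      gcongr
      rw [div_le_one ht]
      linarith
    _ = 0 + ε := by ring

lemma measurable_dil (x₀ : Euc d) (a : ℝ) : Measurable (dil x₀ a) := by
  unfold dil
  fun_prop

lemma map_dil_injective (x₀ : Euc d) {a : ℝ} (ha : a ≠ 0) :
    Function.Injective fun μ : Measure (Euc d) => μ.map (dil x₀ a) := by
  refine Function.LeftInverse.injective (g := fun μ => μ.map (dil x₀ a⁻¹)) fun μ => ?_
  have hcomp : dil x₀ a⁻¹ ∘ dil x₀ a = id := by
    funext x
    simp [dil, smul_smul, inv_mul_cancel₀ ha]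
  simp only
  rw [Measure.map_map (measurable_dil x₀ _) (measurable_dil x₀ _), hcomp, Measure.map_id]

lemma memP2_nm (x₀ : Euc d) {μ : Measure (Euc d)} (hμ : MemM μ) : MemP2 (nm x₀ μ) := by
  have := hμ.1
  unfold nm
  split_ifs with h
  · exact ⟨inferInstance, integrable_dirac (by simp)⟩
  · refine ⟨⟨?_⟩, hμ.2.smul_measure (by simpa using h)⟩
    simp [ENNReal.inv_mul_cancel h (measure_ne_top μ _)]

lemma MemP2.map_dil (x₀ : Euc d) (a : ℝ) {μ : Measure (Euc d)} (hμ : MemP2 μ) :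
    MemP2 (μ.map (dil x₀ a)) := by
  have := hμ.1
  have hm := measurable_dil x₀ a
  refine ⟨Measure.isProbabilityMeasure_map hm.aemeasurable, ?_⟩
  rw [integrable_map_measure (by fun_prop) hm.aemeasurable]
  refine ((hμ.2.const_mul (2 * a ^ 2)).add (integrable_const (2 * ‖a • x₀ - x₀‖ ^ 2))).mono'
    (by fun_prop) (.of_forall fun x => ?_)
  have hx := norm_sub_sq_le_two_mul (a • x) (a • x₀ - x₀)
  have heq : dil x₀ a x = a • x - (a • x₀ - x₀) := by
    rw [dil, smul_sub]
    abel
  rw [norm_smul, mul_pow, Real.norm_eq_abs, sq_abs] at hx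
  simp only [Function.comp_apply, Pi.add_apply, heq]
  rw [Real.norm_of_nonneg (by positivity)]
  linarith

lemma eq_of_mass_eq_of_map_eq (x₀ : Euc d) {μ ν : Measure (Euc d)} (hμ : MemM μ) (hν : MemM ν)
    (hmass : mass μ = mass ν)
    (h : (nm x₀ μ).map (dil x₀ (mass μ)) = (nm x₀ ν).map (dil x₀ (mass ν))) : μ = ν := by
  have := hμ.1
  have := hν.1
  have huniv : μ Set.univ = ν Set.univ :=
    (ENNReal.toReal_eq_toReal_iff' (measure_ne_top _ _) (measure_ne_top _ _)).1 hmass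
  by_cases h0 : μ Set.univ = 0
  · rw [Measure.measure_univ_eq_zero.1 h0, Measure.measure_univ_eq_zero.1 (huniv.symm.trans h0)]
  · have hne : mass μ ≠ 0 := ENNReal.toReal_ne_zero.2 ⟨h0, measure_ne_top _ _⟩
    rw [← hmass] at h
    have hnm : nm x₀ μ = nm x₀ ν := map_dil_injective x₀ hne h
    rw [nm, nm, ← huniv, if_neg h0, if_neg h0] at hnm
    have hcancel := congrArg (μ Set.univ • ·) hnm
    simpa [smul_smul, ENNReal.mul_inv_cancel h0 (measure_ne_top μ _)] using hcancel

lemma sqrt_sq_add_sq_le_of_le_add {a b c u v w : ℝ} (hu : 0 ≤ u) (h1 : |a| ≤ |b| + |c|)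
    (h2 : u ≤ v + w) :
    √(a ^ 2 + u ^ 2) ≤ √(b ^ 2 + v ^ 2) + √(c ^ 2 + w ^ 2) := by
  have hab : a ^ 2 ≤ (|b| + |c|) ^ 2 := by
    rw [← sq_abs a]
    exact pow_le_pow_left₀ (abs_nonneg a) h1 2
  have huv : u ^ 2 ≤ (v + w) ^ 2 := pow_le_pow_left₀ hu h2 2
  have hcs : |b| * |c| + v * w ≤ √(b ^ 2 + v ^ 2) * √(c ^ 2 + w ^ 2) := by
    rw [← Real.sqrt_mul (by positivity)]
    refine Real.le_sqrt_of_sq_le ?_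
    rw [← sq_abs b, ← sq_abs c]
    nlinarith [sq_nonneg (|b| * w - |c| * v)]
  refine Real.sqrt_le_iff.2 ⟨by positivity, ?_⟩
  rw [add_sq, Real.sq_sqrt (by positivity), Real.sq_sqrt (by positivity)]
  nlinarith [sq_abs b, sq_abs c]

lemma WOP_eq_sqrt (x₀ : Euc d) (μ ν : Measure (Euc d)) :
    WOP x₀ μ ν = √((mass μ - mass ν) ^ 2 +
      W2 ((nm x₀ μ).map (dil x₀ (mass μ))) ((nm x₀ ν).map (dil x₀ (mass ν))) ^ 2) := by
  rw [WOP, WOP2, W2, Real.sq_sqrt (W2sq_nonneg _ _)]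

/-- `WOP` is a metric on `M(ℝ^d)`. -/
theorem WOP_isMetric (d : ℕ) (x₀ : Euc d) (μ ν η : Measure (Euc d))
    (hμ : MemM μ) (hν : MemM ν) (hη : MemM η) :
    0 ≤ WOP x₀ μ ν ∧ (WOP x₀ μ ν = 0 ↔ μ = ν) ∧ WOP x₀ μ ν = WOP x₀ ν μ ∧
      WOP x₀ μ ν ≤ WOP x₀ μ η + WOP x₀ η ν := by
  have memP2_map {ρ : Measure (Euc d)} (hρ : MemM ρ) :
      MemP2 ((nm x₀ ρ).map (dil x₀ (mass ρ))) := (memP2_nm x₀ hρ).map_dil x₀ _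
  refine ⟨Real.sqrt_nonneg _, ⟨fun h => ?_, ?_⟩, ?_, ?_⟩
  · have hW := W2sq_nonneg ((nm x₀ μ).map (dil x₀ (mass μ))) ((nm x₀ ν).map (dil x₀ (mass ν)))
    rw [WOP, Real.sqrt_eq_zero (by unfold WOP2; positivity), WOP2,
      add_eq_zero_iff_of_nonneg (sq_nonneg _) hW, sq_eq_zero_iff, sub_eq_zero] at h
    exact eq_of_mass_eq_of_map_eq x₀ hμ hν h.1
      (eq_of_W2sq_eq_zero (memP2_map hμ) (memP2_map hν) h.2)
  · rintro rfl
    simp [WOP, WOP2, W2sq_self]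
  · rw [WOP, WOP, WOP2, WOP2, W2sq_comm, sub_sq_comm]
  · simp only [WOP_eq_sqrt]
    exact sqrt_sq_add_sq_le_of_le_add (Real.sqrt_nonneg _) (abs_sub_le _ _ _)
      (W2_triangle (memP2_map hμ) (memP2_map hν) (memP2_map hη))

end
end

section
/- For any two reference points x₀, y₀ ∈ ℝ^d and all μ, ν ∈ M(ℝ^d), WOP_{x₀}²(μ,ν) = WOP_{y₀}²(μ,ν) + (m_μ−m_ν)·[M_{x₀}(μ) − M_{y₀}(μ) + M_{y₀}(ν) − M_{x₀}(ν)]. In particular, WOP depends on the reference point only through second moments centered at that point. -/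
open MeasureTheory

noncomputable section

variable {d : ℕ}

/-- The measure of `μ` normalized to a probability and dilated by its mass. -/
def dilNm (x₀ : Euc d) (μ : Measure (Euc d)) : Measure (Euc d) :=
  (nm x₀ μ).map (dil x₀ (mass μ))

lemma isProbabilityMeasure_nm (x₀ : Euc d) (μ : Measure (Euc d)) [IsFiniteMeasure μ] :
    IsProbabilityMeasure (nm x₀ μ) := by
  unfold nm
  split_ifs with h
  · infer_instance
  · exact ⟨by simp [ENNReal.inv_mul_cancel h (measure_ne_top μ _)]⟩

lemma memLp_id_nm (x₀ : Euc d) (μ : Measure (Euc d)) [IsFiniteMeasure μ] (h : MemLp id 2 μ) :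
    MemLp id 2 (nm x₀ μ) := by
  unfold nm
  split_ifs with h0
  · exact (memLp_two_iff_integrable_sq_norm (by fun_prop)).2 (integrable_dirac (by simp))
  · exact h.smul_measure (by simpa using h0)

lemma MemM.memLp_id {μ : Measure (Euc d)} (h : MemM μ) : MemLp id 2 μ :=
  (memLp_two_iff_integrable_sq_norm (by fun_prop)).2 h.2

lemma memLp_id_map_dil (x₀ : Euc d) (a : ℝ) (ρ : Measure (Euc d)) [IsFiniteMeasure ρ]
    (h : MemLp id 2 ρ) : MemLp id 2 (ρ.map (dil x₀ a)) := by
  rw [memLp_map_measure_iff (by fun_prop) (measurable_dil x₀ a).aemeasurable]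
  exact ((h.sub (memLp_const x₀)).const_smul a).add (memLp_const x₀)

lemma integral_dilNm (x₀ : Euc d) (μ : Measure (Euc d)) [IsFiniteMeasure μ]
    (h : Integrable id μ) :
    ∫ x, x ∂(dilNm x₀ μ) = ∫ x, x ∂μ - mass μ • x₀ + x₀ := by
  unfold dilNm
  rw [integral_map (measurable_dil x₀ _).aemeasurable (by fun_prop)]
  unfold nm
  split_ifs with h0
  · have hμ : μ = 0 := Measure.measure_univ_eq_zero.1 h0
    subst hμ
    simp [dil, mass]
  · have hm : mass μ ≠ 0 := ENNReal.toReal_ne_zero.2 ⟨h0, measure_ne_top μ _⟩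
    have hr : μ.real Set.univ = mass μ := rfl
    have h' : Integrable (fun x : Euc d => x) μ := h
    have hs : Integrable (fun x : Euc d => x - x₀) μ := h'.sub (integrable_const _)
    have hms : Integrable (fun x : Euc d => mass μ • (x - x₀)) μ := hs.smul (mass μ)
    simp only [dil]
    rw [integral_smul_measure, integral_add hms (integrable_const _), integral_smul,
      integral_sub h' (integrable_const _), integral_const, hr,
      ENNReal.toReal_inv]
    change (mass μ)⁻¹ • _ = _
    rw [← smul_add, inv_smul_smul₀ hm]

lemma dilNm_eq_map_add (x₀ y₀ : Euc d) (μ : Measure (Euc d)) :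
    dilNm x₀ μ = (dilNm y₀ μ).map (· + (1 - mass μ) • (x₀ - y₀)) := by
  unfold dilNm
  rw [Measure.map_map (by fun_prop) (measurable_dil y₀ _)]
  unfold nm
  split_ifs with h0
  · have hμ : μ = 0 := Measure.measure_univ_eq_zero.1 h0
    subst hμ
    rw [Measure.map_dirac, Measure.map_dirac]
    simp [dil, mass]
  · congr 1
    ext1 x
    simp only [dil, Function.comp]
    module

/-- Translating the marginals changes the cost of a coupling of `ρ` and `σ` by this amount. -/
def translationCost (ρ σ : Measure (Euc d)) (a b : Euc d) : ℝ :=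
  2 * inner ℝ (∫ x, x ∂ρ - ∫ x, x ∂σ) (a - b) + ‖a - b‖ ^ 2

lemma integral_translate_coupling {ρ σ : Measure (Euc d)} [IsProbabilityMeasure ρ]
    (hρ : MemLp id 2 ρ) (hσ : MemLp id 2 σ) (a b : Euc d) {π : Measure (Euc d × Euc d)}
    (h₁ : π.map Prod.fst = ρ) (h₂ : π.map Prod.snd = σ) :
    ∫ p, ‖(p.1 + a) - (p.2 + b)‖ ^ 2 ∂π
      = ∫ p, ‖p.1 - p.2‖ ^ 2 ∂π + translationCost ρ σ a b := by
  have : IsProbabilityMeasure π := by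
    refine ⟨?_⟩
    rw [← measure_univ (μ := ρ), ← h₁, Measure.map_apply measurable_fst .univ, Set.preimage_univ]
  have L₁ : MemLp (fun p : Euc d × Euc d => p.1) 2 π := by
    rw [← h₁, memLp_map_measure_iff (by fun_prop) (by fun_prop)] at hρ
    exact hρ
  have L₂ : MemLp (fun p : Euc d × Euc d => p.2) 2 π := by
    rw [← h₂, memLp_map_measure_iff (by fun_prop) (by fun_prop)] at hσ
    exact hσ
  have I₁ := L₁.integrable one_le_two
  have I₂ := L₂.integrable one_le_two
  have hd : Integrable (fun p : Euc d × Euc d => p.1 - p.2) π := I₁.sub I₂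
  have hsq : Integrable (fun p : Euc d × Euc d => ‖p.1 - p.2‖ ^ 2) π :=
    (L₁.sub L₂).integrable_norm_pow two_ne_zero
  have hi : Integrable (fun p : Euc d × Euc d => 2 * inner ℝ (p.1 - p.2) (a - b)) π :=
    (hd.inner_const _).const_mul 2
  have hsum : Integrable (fun p : Euc d × Euc d =>
      ‖p.1 - p.2‖ ^ 2 + 2 * inner ℝ (p.1 - p.2) (a - b)) π := hsq.add hi
  have e₁ : ∫ x, x ∂ρ = ∫ p, p.1 ∂π := by
    rw [← h₁, integral_map (by fun_prop) (by fun_prop)]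
  have e₂ : ∫ x, x ∂σ = ∫ p, p.2 ∂π := by
    rw [← h₂, integral_map (by fun_prop) (by fun_prop)]
  have hmean : ∫ p, inner ℝ (p.1 - p.2) (a - b) ∂π
      = inner ℝ (∫ p, (p.1 - p.2) ∂π) (a - b) := by
    simp_rw [real_inner_comm (a - b)]
    exact integral_inner hd (a - b)
  have hpt : ∀ p : Euc d × Euc d, ‖(p.1 + a) - (p.2 + b)‖ ^ 2
      = ‖p.1 - p.2‖ ^ 2 + 2 * inner ℝ (p.1 - p.2) (a - b) + ‖a - b‖ ^ 2 := fun p => by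
    rw [add_sub_add_comm, norm_add_sq_real]
  simp_rw [hpt]
  rw [integral_add hsum (integrable_const _), integral_add hsq hi,
    integral_const_mul, hmean, integral_sub I₁ I₂, translationCost, e₁, e₂]
  simp [add_assoc]

lemma W2sq_map_add_le {ρ σ : Measure (Euc d)} [IsProbabilityMeasure ρ] [IsProbabilityMeasure σ]
    (hρ : MemLp id 2 ρ) (hσ : MemLp id 2 σ) (a b : Euc d) :
    W2sq (ρ.map (· + a)) (σ.map (· + b)) ≤ W2sq ρ σ + translationCost ρ σ a b := by
  rw [← sub_le_iff_le_add]
  refine le_csInf ⟨_, ρ.prod σ, by simp, by simp, rfl⟩ ?_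
  rintro _ ⟨π, h₁, h₂, rfl⟩
  rw [sub_le_iff_le_add, ← integral_translate_coupling hρ hσ a b h₁ h₂]
  refine csInf_le ⟨0, ?_⟩ ⟨π.map (Prod.map (· + a) (· + b)), ?_, ?_, ?_⟩
  · rintro _ ⟨_, -, -, rfl⟩
    positivity
  · rw [Measure.map_map (by fun_prop) (by fun_prop), ← h₁,
      Measure.map_map (by fun_prop) (by fun_prop)]
    rfl
  · rw [Measure.map_map (by fun_prop) (by fun_prop), ← h₂,
      Measure.map_map (by fun_prop) (by fun_prop)]
    rfl
  · rw [integral_map (by fun_prop) (by fun_prop)]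
    rfl

lemma memLp_id_map_add {ρ : Measure (Euc d)} [IsFiniteMeasure ρ] (hρ : MemLp id 2 ρ)
    (a : Euc d) : MemLp id 2 (ρ.map (· + a)) := by
  rw [memLp_map_measure_iff (by fun_prop) (by fun_prop)]
  exact hρ.add (memLp_const a)

lemma integral_map_add_const {ρ : Measure (Euc d)} [IsProbabilityMeasure ρ] (hρ : MemLp id 2 ρ)
    (a : Euc d) : ∫ x, x ∂(ρ.map (· + a)) = ∫ x, x ∂ρ + a := by
  have h : Integrable (fun x : Euc d => x) ρ := hρ.integrable one_le_two
  rw [integral_map (by fun_prop) (by fun_prop), integral_add h (integrable_const a)]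
  simp

lemma map_add_map_neg (ρ : Measure (Euc d)) (a : Euc d) :
    (ρ.map (· + a)).map (· + -a) = ρ := by
  rw [Measure.map_map (by fun_prop) (by fun_prop)]
  convert Measure.map_id (μ := ρ)
  ext1 x
  simp

lemma W2sq_map_add {ρ σ : Measure (Euc d)} [IsProbabilityMeasure ρ] [IsProbabilityMeasure σ]
    (hρ : MemLp id 2 ρ) (hσ : MemLp id 2 σ) (a b : Euc d) :
    W2sq (ρ.map (· + a)) (σ.map (· + b)) = W2sq ρ σ + translationCost ρ σ a b := by
  refine le_antisymm (W2sq_map_add_le hρ hσ a b) ?_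
  have := Measure.isProbabilityMeasure_map (μ := ρ) (f := (· + a)) (by fun_prop)
  have := Measure.isProbabilityMeasure_map (μ := σ) (f := (· + b)) (by fun_prop)
  have h := W2sq_map_add_le (memLp_id_map_add hρ a) (memLp_id_map_add hσ b) (-a) (-b)
  rw [map_add_map_neg, map_add_map_neg] at h
  have hc : translationCost (ρ.map (· + a)) (σ.map (· + b)) (-a) (-b)
      = -translationCost ρ σ a b := by
    unfold translationCost
    rw [integral_map_add_const hρ, integral_map_add_const hσ, add_sub_add_comm,
      neg_sub_neg, ← neg_sub a b, norm_neg, inner_neg_right, inner_add_left,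
      real_inner_self_eq_norm_sq]
    ring
  linarith

lemma sndMoment_eq {μ : Measure (Euc d)} (hμ : MemM μ) (x₀ : Euc d) :
    sndMoment x₀ μ = ∫ x, ‖x‖ ^ 2 ∂μ - 2 * inner ℝ (∫ x, x ∂μ) x₀ + mass μ * ‖x₀‖ ^ 2 := by
  have := hμ.1
  have hI : Integrable (fun x : Euc d => x) μ := hμ.memLp_id.integrable one_le_two
  have hmean : ∫ x, inner ℝ x x₀ ∂μ = inner ℝ (∫ x, x ∂μ) x₀ := by
    simp_rw [real_inner_comm x₀]
    exact integral_inner hI x₀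
  have hi : Integrable (fun x : Euc d => 2 * inner ℝ x x₀) μ := (hI.inner_const x₀).const_mul 2
  have hsub : Integrable (fun x : Euc d => ‖x‖ ^ 2 - 2 * inner ℝ x x₀) μ := hμ.2.sub hi
  unfold sndMoment
  simp_rw [norm_sub_sq_real]
  rw [integral_add hsub (integrable_const _), integral_sub hμ.2 hi,
    integral_const_mul, hmean, integral_const]
  rfl

/-- dependence of `WOP` on the reference point. -/
theorem WOP2_ref_point_change (d : ℕ) (x₀ y₀ : Euc d) (μ ν : Measure (Euc d))
    (hμ : MemM μ) (hν : MemM ν) :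
    WOP2 x₀ μ ν = WOP2 y₀ μ ν + (mass μ - mass ν) *
      (sndMoment x₀ μ - sndMoment y₀ μ + sndMoment y₀ ν - sndMoment x₀ ν) := by
  have := hμ.1
  have := hν.1
  have hP (ρ : Measure (Euc d)) [IsFiniteMeasure ρ] : IsProbabilityMeasure (dilNm y₀ ρ) :=
    have := isProbabilityMeasure_nm y₀ ρ
    Measure.isProbabilityMeasure_map (measurable_dil y₀ _).aemeasurable
  have hL {ρ : Measure (Euc d)} (hρ : MemM ρ) : MemLp id 2 (dilNm y₀ ρ) :=
    have := hρ.1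
    have := isProbabilityMeasure_nm y₀ ρ
    memLp_id_map_dil y₀ _ _ (memLp_id_nm y₀ ρ hρ.memLp_id)
  have := hP μ
  have := hP ν
  have key := W2sq_map_add (hL hμ) (hL hν) ((1 - mass μ) • (x₀ - y₀)) ((1 - mass ν) • (x₀ - y₀))
  rw [← dilNm_eq_map_add, ← dilNm_eq_map_add] at key
  change (mass μ - mass ν) ^ 2 + W2sq (dilNm x₀ μ) (dilNm x₀ ν)
    = (mass μ - mass ν) ^ 2 + W2sq (dilNm y₀ μ) (dilNm y₀ ν) + _
  rw [key, translationCost, integral_dilNm y₀ μ (hμ.memLp_id.integrable one_le_two),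
    integral_dilNm y₀ ν (hν.memLp_id.integrable one_le_two), sndMoment_eq hμ, sndMoment_eq hμ,
    sndMoment_eq hν, sndMoment_eq hν, ← sub_smul, ← real_inner_self_eq_norm_sq (_ • _),
    ← real_inner_self_eq_norm_sq x₀, ← real_inner_self_eq_norm_sq y₀]
  simp only [inner_add_left, inner_sub_left, inner_sub_right, real_inner_smul_left,
    real_inner_smul_right, real_inner_comm x₀ y₀]
  ring

end
end
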